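/- Let α ∈ (1/2, 1) and let τ₀, k₀, ρ*, μ₀ be positive constants. Define the viscous energy with the normalizing constant e₀ = (k₀²/(ρ* μ₀)) ∫_0^∞ (E_α(−(u/τ₀)^α))² du, namely g(s) = e₀ − (k₀²/(ρ* μ₀)) ∫_0^s (E_α(−(u/τ₀)^α))² du = (k₀²/(ρ* μ₀)) ∫_s^∞ (E_α(−(u/τ₀)^α))² du. Then e₀ is finite, g is nonincreasing on [0, ∞) with 0 ≤ g(s) ≤ e₀ for all s ≥ 0, and g(s) → 0 as s → +∞ (equivalently, the viscous energy e^{(V)}(σ) is bounded for all σ ∈ [0, k₀] and tends to 0 as σ → 0). -/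

import Mathlib

/-- The two-parameter Mittag-Leffler function `E_{α,β}(x) = ∑ x ^ k / Γ(α k + β)`
for real `x`. The classical Mittag-Leffler function is `E_α = E_{α,1}`. -/
noncomputable def mittagLeffler (α β : ℝ) (x : ℝ) : ℝ :=
  ∑' k : ℕ, x ^ k / Real.Gamma (α * k + β)

open MeasureTheory Set Filter Topology

theorem Real.rpow_mul_exp_neg_le_Gamma {A s : ℝ} (hA : 0 < A) (hs : 1 ≤ s) :
    A ^ (s - 1) * Real.exp (-A) ≤ Real.Gamma s := by
  rw [Real.Gamma_eq_integral (by linarith), ← integral_exp_neg_Ioi, ← integral_const_mul]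
  have hfi := Real.GammaIntegral_convergent (s := s) (by linarith)
  calc ∫ x in Ioi A, A ^ (s - 1) * Real.exp (-x)
      ≤ ∫ x in Ioi A, Real.exp (-x) * x ^ (s - 1) := by
        refine setIntegral_mono_on ((integrableOn_exp_neg_Ioi A).const_mul _)
          (hfi.mono_set (Ioi_subset_Ioi hA.le)) measurableSet_Ioi fun x hx => ?_
        rw [mul_comm]
        have : A ^ (s - 1) ≤ x ^ (s - 1) :=
          Real.rpow_le_rpow hA.le (le_of_lt hx) (by linarith)
        gcongr
    _ ≤ ∫ x in Ioi 0, Real.exp (-x) * x ^ (s - 1) := by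
        refine setIntegral_mono_set hfi ?_ (Ioi_subset_Ioi hA.le).eventuallyLE
        filter_upwards [ae_restrict_mem measurableSet_Ioi] with x hx
        have : 0 < x := hx
        positivity

theorem mittagLeffler_coeff_pos {α β : ℝ} (hα : 0 < α) (hβ : 0 < β) (k : ℕ) :
    0 < Real.Gamma (α * k + β) :=
  Real.Gamma_pos_of_pos (by positivity)

theorem summable_mittagLeffler_of_nonneg {α β M : ℝ} (hα : 0 < α) (hβ : 0 < β) (hM : 0 ≤ M) :
    Summable fun k : ℕ => M ^ k / Real.Gamma (α * k + β) := by
  set A : ℝ := (2 * (M + 1)) ^ (1 / α) with hA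
  have hA0 : 0 < A := by positivity
  have hAα : A ^ α = 2 * (M + 1) := by
    rw [hA, ← Real.rpow_mul (by positivity), one_div_mul_cancel hα.ne', Real.rpow_one]
  have hgeom : Summable fun k : ℕ => (Real.exp A * A ^ (1 - β)) * (1 / 2 : ℝ) ^ k :=
    (summable_geometric_of_lt_one (by norm_num) (by norm_num)).mul_left _
  refine hgeom.of_norm_bounded_eventually_nat ?_
  filter_upwards [eventually_ge_atTop ⌈1 / α⌉₊] with k hk
  have hk' : 1 ≤ α * k := by
    have : 1 / α ≤ k := Nat.ceil_le.mp hk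
    rwa [div_le_iff₀' hα] at this
  have hG := Real.rpow_mul_exp_neg_le_Gamma hA0 (s := α * k + β) (by linarith)
  have hpos := mittagLeffler_coeff_pos hα hβ k
  rw [Real.norm_of_nonneg (by positivity), div_le_iff₀ hpos]
  have e1 : A ^ (α * k + β - 1) = (2 * (M + 1)) ^ k * A ^ (β - 1) := by
    rw [show α * k + β - 1 = α * k + (β - 1) by ring, Real.rpow_add hA0, Real.rpow_mul hA0.le,
      hAα, Real.rpow_natCast]
  have e2 : A ^ (1 - β) * A ^ (β - 1) = 1 := by
    rw [← Real.rpow_add hA0]; simp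
  calc M ^ k ≤ (M + 1) ^ k := by gcongr; linarith
    _ = Real.exp A * A ^ (1 - β) * (1 / 2) ^ k * (A ^ (α * k + β - 1) * Real.exp (-A)) := by
        rw [e1, Real.exp_neg, mul_pow, div_pow, one_pow]
        have := Real.exp_pos A
        field_simp
        exact e2.symm
    _ ≤ _ := by gcongr

theorem summable_mittagLeffler {α β : ℝ} (hα : 0 < α) (hβ : 0 < β) (x : ℝ) :
    Summable fun k : ℕ => x ^ k / Real.Gamma (α * k + β) := by
  refine Summable.of_norm ((summable_mittagLeffler_of_nonneg hα hβ (abs_nonneg x)).congr ?_)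
  intro k
  simp [abs_of_pos (mittagLeffler_coeff_pos hα hβ k)]

theorem continuous_mittagLeffler {α β : ℝ} (hα : 0 < α) (hβ : 0 < β) :
    Continuous (mittagLeffler α β) := by
  refine continuous_iff_continuousAt.mpr fun x => ?_
  have hx : Metric.closedBall (0 : ℝ) (|x| + 1) ∈ 𝓝 x :=
    mem_of_superset (Metric.isOpen_ball.mem_nhds (by simp)) Metric.ball_subset_closedBall
  refine ContinuousOn.continuousAt ?_ hx
  refine continuousOn_tsum (fun k => by fun_prop)
    (summable_mittagLeffler_of_nonneg hα hβ (M := |x| + 1) (by positivity)) fun k y hy => ?_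
  have hy' : |y| ≤ |x| + 1 := by simpa using hy
  have hpos := mittagLeffler_coeff_pos hα hβ k
  rw [norm_div, norm_pow, Real.norm_eq_abs, Real.norm_eq_abs, abs_of_pos hpos]
  gcongr

theorem continuous_mittagLeffler_neg_rpow {α γ : ℝ} (hα : 0 < α) (hγ : 0 < γ) :
    Continuous fun t : ℝ => mittagLeffler α γ (-(t ^ α)) :=
  (continuous_mittagLeffler hα hγ).comp (Real.continuous_rpow_const hα.le).neg

theorem mittagLeffler_zero (α β : ℝ) : mittagLeffler α β 0 = 1 / Real.Gamma β := by
  rw [mittagLeffler, tsum_eq_single 0]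
  · simp
  · intro k hk
    simp [hk]

theorem mittagLeffler_recurrence {α β : ℝ} (hα : 0 < α) (hβ : 0 < β) (x : ℝ) :
    mittagLeffler α β x = 1 / Real.Gamma β + x * mittagLeffler α (β + α) x := by
  rw [mittagLeffler, (summable_mittagLeffler hα hβ x).tsum_eq_zero_add, mittagLeffler,
    ← tsum_mul_left]
  congr 1
  · simp
  · refine tsum_congr fun k => ?_
    rw [show α * ((k + 1 : ℕ) : ℝ) + β = α * k + (β + α) by push_cast; ring]
    ring

/-- The real Euler beta integral over `(0, t]`. -/
theorem integral_rpow_mul_sub_rpow {a b t : ℝ} (ha : 0 < a) (hb : 0 < b) (ht : 0 < t) :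
    ∫ s in Ioc 0 t, s ^ (a - 1) * (t - s) ^ (b - 1) =
      t ^ (a + b - 1) * (Real.Gamma a * Real.Gamma b / Real.Gamma (a + b)) := by
  have h := Complex.betaIntegral_scaled a b ht
  rw [Complex.betaIntegral_eq_Gamma_mul_div a b (by simpa) (by simpa),
    intervalIntegral.integral_of_le ht.le] at h
  have h2 : ∫ s in Ioc 0 t, (s : ℂ) ^ ((a : ℂ) - 1) * ((t : ℂ) - s) ^ ((b : ℂ) - 1) =
      ∫ s in Ioc 0 t, ((s ^ (a - 1) * (t - s) ^ (b - 1) : ℝ) : ℂ) := by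
    refine setIntegral_congr_fun measurableSet_Ioc fun s hs => ?_
    rw [Complex.ofReal_mul, Complex.ofReal_cpow hs.1.le, Complex.ofReal_cpow (sub_nonneg.2 hs.2)]
    push_cast
    rfl
  rw [h2, integral_complex_ofReal] at h
  apply Complex.ofReal_injective
  rw [h, ← Complex.ofReal_add, Complex.Gamma_ofReal, Complex.Gamma_ofReal, Complex.Gamma_ofReal,
    ← Complex.ofReal_one, ← Complex.ofReal_sub, ← Complex.ofReal_cpow ht.le]
  push_cast
  rfl

theorem integrableOn_rpow_mul_sub_rpow {a b t : ℝ} (ha : 0 < a) (hb : 0 < b) (ht : 0 < t) :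
    IntegrableOn (fun s => s ^ (a - 1) * (t - s) ^ (b - 1)) (Ioc 0 t) := by
  refine Integrable.of_integral_ne_zero ?_
  rw [integral_rpow_mul_sub_rpow ha hb ht]
  have := Real.Gamma_pos_of_pos ha
  have := Real.Gamma_pos_of_pos hb
  have := Real.Gamma_pos_of_pos (add_pos ha hb)
  positivity

/-- The fractional relaxation kernel `t ^ (γ - 1) * E_{α,γ}(-t ^ α)`. -/
noncomputable def mittagLefflerKernel (α γ t : ℝ) : ℝ :=
  t ^ (γ - 1) * mittagLeffler α γ (-(t ^ α))

theorem integrableOn_mittagLefflerKernel_mul {α γ β t : ℝ} (hα : 0 < α) (hγ : 0 < γ) (hβ : 0 < β)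
    (ht : 0 < t) :
    IntegrableOn (fun s => mittagLefflerKernel α γ s * (t - s) ^ (β - 1)) (Ioc 0 t) := by
  have h1 := (integrableOn_Icc_iff_integrableOn_Ioc).mpr (integrableOn_rpow_mul_sub_rpow hγ hβ ht)
  have h2 := (continuous_mittagLeffler_neg_rpow hα hγ).continuousOn (s := Icc 0 t)
  refine (integrableOn_Icc_iff_integrableOn_Ioc).mp
    ((h1.continuousOn_mul h2 isCompact_Icc).congr_fun (fun s _ => ?_) measurableSet_Icc)
  simp only [mittagLefflerKernel]
  ring

/-- Fractional integration of order `β` raises the second index of the kernel by `β`. -/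
theorem integral_mittagLefflerKernel_mul {α γ β t : ℝ} (hα : 0 < α) (hγ : 0 < γ) (hβ : 0 < β)
    (ht : 0 < t) :
    ∫ s in Ioc 0 t, mittagLefflerKernel α γ s * (t - s) ^ (β - 1) =
      Real.Gamma β * mittagLefflerKernel α (γ + β) t := by
  have hexp : ∀ k : ℕ, 0 < α * k + γ := fun k => by positivity
  let c : ℕ → ℝ := fun k => (-1) ^ k / Real.Gamma (α * k + γ)
  let F : ℕ → ℝ → ℝ := fun k s => c k * (s ^ (α * k + γ - 1) * (t - s) ^ (β - 1))
  have hFint : ∀ k, Integrable (F k) (volume.restrict (Ioc 0 t)) := fun k =>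
    (integrableOn_rpow_mul_sub_rpow (hexp k) hβ ht).const_mul _
  have hpow : ∀ s : ℝ, 0 < s → ∀ (k : ℕ) (δ : ℝ),
      s ^ (α * k + δ - 1) = (s ^ α) ^ k * s ^ (δ - 1) := fun s hs k δ => by
    rw [show α * k + δ - 1 = α * k + (δ - 1) by ring, Real.rpow_add hs, Real.rpow_mul hs.le,
      Real.rpow_natCast]
  have hval : ∀ k : ℕ, ∫ s in Ioc 0 t, s ^ (α * k + γ - 1) * (t - s) ^ (β - 1) =
      Real.Gamma (α * k + γ) * (Real.Gamma β * t ^ (γ + β - 1) *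
        ((t ^ α) ^ k / Real.Gamma (α * k + (γ + β)))) := fun k => by
    rw [integral_rpow_mul_sub_rpow (hexp k) hβ ht, add_assoc, hpow t ht]
    ring
  have hFval : ∀ k, ∫ s in Ioc 0 t, F k s = Real.Gamma β * t ^ (γ + β - 1) *
      ((-(t ^ α)) ^ k / Real.Gamma (α * k + (γ + β))) := fun k => by
    have := (mittagLeffler_coeff_pos hα hγ k).ne'
    simp only [F, c]
    rw [integral_const_mul, hval, neg_pow (t ^ α) k]
    field_simp
  have hFnorm : ∀ k, ∫ s in Ioc 0 t, ‖F k s‖ = Real.Gamma β * t ^ (γ + β - 1) *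
      ((t ^ α) ^ k / Real.Gamma (α * k + (γ + β))) := fun k => by
    have hG := mittagLeffler_coeff_pos hα hγ k
    have : ∫ s in Ioc 0 t, ‖F k s‖ = ∫ s in Ioc 0 t, (1 / Real.Gamma (α * k + γ)) *
        (s ^ (α * k + γ - 1) * (t - s) ^ (β - 1)) := by
      refine setIntegral_congr_fun measurableSet_Ioc fun s hs => ?_
      have h1 : 0 ≤ s ^ (α * k + γ - 1) := Real.rpow_nonneg hs.1.le _
      have h2 : 0 ≤ (t - s) ^ (β - 1) := Real.rpow_nonneg (sub_nonneg.2 hs.2) _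
      simp [F, c, abs_of_pos hG, abs_of_nonneg h1, abs_of_nonneg h2]
    rw [this, integral_const_mul, hval]
    field_simp
  have hsum := hasSum_integral_of_summable_integral_norm hFint (by
    simp_rw [hFnorm]
    exact (summable_mittagLeffler_of_nonneg hα (by linarith) (by positivity)).mul_left _)
  simp_rw [hFval] at hsum
  have hR := hsum.tsum_eq
  rw [tsum_mul_left] at hR
  rw [mittagLefflerKernel, mittagLeffler, ← mul_assoc, hR]
  refine setIntegral_congr_fun measurableSet_Ioc fun s hs => ?_
  simp only [mittagLefflerKernel, mittagLeffler]
  rw [← tsum_mul_left, ← tsum_mul_right]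
  refine tsum_congr fun k => ?_
  simp only [F, c]
  rw [hpow s hs.1, neg_pow (s ^ α) k]
  ring

theorem mittagLefflerKernel_eq_sub {α γ t : ℝ} (hα : 0 < α) (hγ : 0 < γ) (ht : 0 < t) :
    mittagLefflerKernel α γ t =
      t ^ (γ - 1) / Real.Gamma γ - mittagLefflerKernel α (γ + α) t := by
  rw [mittagLefflerKernel, mittagLefflerKernel, mittagLeffler_recurrence hα hγ,
    show γ + α - 1 = γ - 1 + α by ring, Real.rpow_add ht]
  ring

theorem mittagLefflerKernel_volterra {α γ t : ℝ} (hα : 0 < α) (hγ : 0 < γ) (ht : 0 < t) :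
    Real.Gamma α * mittagLefflerKernel α γ t =
      Real.Gamma α * (t ^ (γ - 1) / Real.Gamma γ) -
        ∫ s in Ioc 0 t, mittagLefflerKernel α γ s * (t - s) ^ (α - 1) := by
  rw [integral_mittagLefflerKernel_mul hα hγ hα ht, mittagLefflerKernel_eq_sub hα hγ ht, mul_sub]

theorem continuousOn_mittagLefflerKernel {α γ : ℝ} (hα : 0 < α) (hγ : 0 < γ) :
    ContinuousOn (mittagLefflerKernel α γ) (Ioi 0) :=
  ContinuousOn.mul (fun _ ht =>
    (Real.continuousAt_rpow_const _ _ (Or.inl (ne_of_gt ht))).continuousWithinAt)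
    (continuous_mittagLeffler_neg_rpow hα hγ).continuousOn

theorem integrableOn_sub_rpow {α m t : ℝ} (hα : 0 < α) (hmt : m ≤ t) :
    IntegrableOn (fun s => (t - s) ^ (α - 1)) (Ioc m t) := by
  rw [← intervalIntegrable_iff_integrableOn_Ioc_of_le hmt]
  have h := (intervalIntegral.intervalIntegrable_rpow' (a := t - m) (b := 0)
    (by linarith : -1 < α - 1)).comp_sub_left t
  simpa using h

theorem integral_sub_rpow {α m t : ℝ} (hα : 0 < α) (hmt : m ≤ t) :
    ∫ s in Ioc m t, (t - s) ^ (α - 1) = (t - m) ^ α / α := by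
  rw [← intervalIntegral.integral_of_le hmt,
    intervalIntegral.integral_comp_sub_left (fun x => x ^ (α - 1)) t, sub_self,
    integral_rpow (Or.inl (by linarith))]
  simp [hα.ne']

/-- The relaxation kernel `t ^ (α - 1) * E_{α,α}(-t ^ α)` is positive: at a first zero `t₀`, the
Volterra equation is compared with the one at a nearby maximum point of the kernel to the left of
`t₀`, using log-convexity of `t ^ (α - 1)`. -/
theorem mittagLefflerKernel_self_pos {α t : ℝ} (hα : 0 < α) (hα1 : α < 1) (ht : 0 < t) :
    0 < mittagLefflerKernel α α t := by
  by_contra! hneg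
  set r := mittagLefflerKernel α α
  have hΓ := Real.Gamma_pos_of_pos hα
  let S : Set ℝ := Ici 0 ∩ {s : ℝ | mittagLeffler α α (-(s ^ α)) ≤ 0}
  have hSc : IsClosed S :=
    isClosed_Ici.inter (isClosed_le (continuous_mittagLeffler_neg_rpow hα hα) continuous_const)
  have hSb : BddBelow S := ⟨0, fun s hs => hs.1⟩
  have hSn : S.Nonempty :=
    ⟨t, ht.le, nonpos_of_mul_nonpos_right hneg (Real.rpow_pos_of_pos ht _)⟩
  obtain ⟨h0, hle⟩ := hSc.csInf_mem hSn hSb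
  set t₀ := sInf S
  have ht₀pos : 0 < t₀ := by
    refine lt_of_le_of_ne h0 fun h => ?_
    rw [mem_ofPred_eq, ← h, Real.zero_rpow hα.ne', neg_zero, mittagLeffler_zero] at hle
    exact absurd hle (not_le.2 (by positivity))
  have hr₀ : r t₀ ≤ 0 := mul_nonpos_of_nonneg_of_nonpos (Real.rpow_nonneg h0 _) hle
  have hrpos : ∀ s, 0 < s → s < t₀ → 0 < r s := fun s hs hst => by
    refine mul_pos (Real.rpow_pos_of_pos hs _) ?_
    by_contra! h
    exact absurd (csInf_le hSb (⟨hs.le, h⟩ : s ∈ S)) (not_le.2 hst)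
  obtain ⟨l, hl, hlsub⟩ : ∃ l < t₀, Ioc l t₀ ⊆
      {s | 0 < (t₀ / s) ^ (α - 1) * Real.Gamma α - (t₀ - s) ^ α / α} := by
    refine exists_Ioc_subset_of_mem_nhds ?_ ⟨0, ht₀pos⟩
    refine ContinuousAt.eventually_lt (f := fun _ => (0 : ℝ)) continuousAt_const ?_ ?_
    · refine ContinuousAt.sub (ContinuousAt.mul (ContinuousAt.rpow_const ?_ ?_)
        continuousAt_const) ?_
      · exact continuousAt_const.div continuousAt_id ht₀pos.ne'
      · left
        rw [div_self ht₀pos.ne']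
        exact one_ne_zero
      · exact ((continuousAt_const.sub continuousAt_id).rpow_const (Or.inr hα.le)).div_const _
    · simp [div_self ht₀pos.ne', Real.zero_rpow hα.ne', hΓ]
  set a := (max l 0 + t₀) / 2 with ha
  have hm1 : max l 0 < t₀ := max_lt hl ht₀pos
  have ha0 : 0 < a := by linarith [le_max_right l 0]
  have hla : l < a := by linarith [le_max_left l 0]
  have hat : a < t₀ := by linarith
  obtain ⟨m, hm, hmax⟩ := isCompact_Icc.exists_isMaxOn (nonempty_Icc.2 hat.le)
    ((continuousOn_mittagLefflerKernel hα hα).mono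
      (fun s hs => lt_of_lt_of_le ha0 hs.1 : Icc a t₀ ⊆ Ioi 0))
  have hmr : 0 < r m := (hrpos a ha0 hat).trans_le (hmax (left_mem_Icc.2 hat.le))
  have hmt : m < t₀ := lt_of_le_of_ne hm.2 fun h => absurd hr₀ (not_le.2 (h ▸ hmr))
  have hm0 : 0 < m := ha0.trans_le hm.1
  have hφ := hlsub (⟨hla.trans_le hm.1, hm.2⟩ : m ∈ Ioc l t₀)
  rw [mem_ofPred_eq] at hφ
  have hI₀ := integrableOn_mittagLefflerKernel_mul hα hα hα ht₀pos
  have hIm := integrableOn_mittagLefflerKernel_mul hα hα hα hm0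
  have hV₀ := mittagLefflerKernel_volterra hα hα ht₀pos
  have hVm := mittagLefflerKernel_volterra hα hα hm0
  rw [← Ioc_union_Ioc_eq_Ioc hm0.le hmt.le, setIntegral_union (Ioc_disjoint_Ioc_of_le le_rfl)
    measurableSet_Ioc (hI₀.mono_set (Ioc_subset_Ioc_right hmt.le))
    (hI₀.mono_set (Ioc_subset_Ioc_left hm0.le))] at hV₀
  have h1 : ∫ s in Ioc 0 m, r s * (t₀ - s) ^ (α - 1) ≤
      (t₀ / m) ^ (α - 1) * ∫ s in Ioc 0 m, r s * (m - s) ^ (α - 1) := by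
    rw [← integral_const_mul, integral_Ioc_eq_integral_Ioo, integral_Ioc_eq_integral_Ioo]
    refine setIntegral_mono_on (hI₀.mono_set (Ioo_subset_Ioc_self.trans
      (Ioc_subset_Ioc_right hmt.le))) ((hIm.mono_set Ioo_subset_Ioc_self).const_mul _)
      measurableSet_Ioo fun s hs => ?_
    rw [mul_left_comm, ← Real.mul_rpow (by positivity) (sub_nonneg.2 hs.2.le)]
    refine mul_le_mul_of_nonneg_left ?_ (hrpos s hs.1 (hs.2.trans hmt)).le
    refine Real.rpow_le_rpow_of_nonpos (mul_pos (by positivity) (sub_pos.2 hs.2)) ?_ (by linarith)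
    have : 1 ≤ t₀ / m := (one_le_div hm0).2 hmt.le
    have e : t₀ / m * (m - s) = t₀ - t₀ / m * s := by field_simp
    rw [e]
    nlinarith [hs.1]
  have h2 : ∫ s in Ioc m t₀, r s * (t₀ - s) ^ (α - 1) ≤ r m * ((t₀ - m) ^ α / α) := by
    rw [← integral_sub_rpow hα hmt.le, ← integral_const_mul]
    refine setIntegral_mono_on (hI₀.mono_set (Ioc_subset_Ioc_left hm0.le))
      ((integrableOn_sub_rpow hα hmt.le).const_mul _) measurableSet_Ioc fun s hs => ?_
    exact mul_le_mul_of_nonneg_right (hmax ⟨hm.1.trans hs.1.le, hs.2⟩)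
      (Real.rpow_nonneg (sub_nonneg.2 hs.2) _)
  have h3 : (t₀ / m) ^ (α - 1) * m ^ (α - 1) = t₀ ^ (α - 1) := by
    rw [← Real.mul_rpow (by positivity) hm0.le, div_mul_cancel₀ _ hm0.ne']
  rw [mul_div_cancel₀ _ hΓ.ne'] at hV₀ hVm
  have h4 : ∫ s in Ioc 0 m, r s * (m - s) ^ (α - 1) = m ^ (α - 1) - Real.Gamma α * r m := by
    linarith
  rw [h4, mul_sub, h3] at h1
  have h5 := mul_pos hmr hφ
  have h6 : Real.Gamma α * r t₀ ≤ 0 := mul_nonpos_of_nonneg_of_nonpos hΓ.le hr₀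
  linarith

theorem mittagLefflerKernel_one (α t : ℝ) :
    mittagLefflerKernel α 1 t = mittagLeffler α 1 (-(t ^ α)) := by
  simp [mittagLefflerKernel]

theorem mittagLefflerKernel_one_nonneg {α t : ℝ} (hα : 0 < α) (hα1 : α < 1) (ht : 0 < t) :
    0 ≤ mittagLefflerKernel α 1 t := by
  have h := integral_mittagLefflerKernel_mul hα hα (sub_pos.2 hα1) ht
  rw [add_sub_cancel] at h
  refine nonneg_of_mul_nonneg_right (h ▸ ?_) (Real.Gamma_pos_of_pos (sub_pos.2 hα1))
  exact setIntegral_nonneg measurableSet_Ioc fun s hs =>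
    mul_nonneg (mittagLefflerKernel_self_pos hα hα1 hs.1).le
      (Real.rpow_nonneg (sub_nonneg.2 hs.2) _)

theorem mittagLefflerKernel_one_antitoneOn {α : ℝ} (hα : 0 < α) (hα1 : α < 1) :
    AntitoneOn (mittagLefflerKernel α 1) (Ioi 0) := by
  have key : ∀ t, 0 < t →
      mittagLefflerKernel α 1 t = 1 - ∫ s in Ioc 0 t, mittagLefflerKernel α α s := fun t ht => by
    have h := integral_mittagLefflerKernel_mul hα hα one_pos ht
    simp only [sub_self, Real.rpow_zero, mul_one, Real.Gamma_one, one_mul] at h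
    rw [h, mittagLefflerKernel_eq_sub hα one_pos ht, add_comm]
    simp
  intro s hs t ht hst
  rw [key s hs, key t ht]
  have hI := integrableOn_mittagLefflerKernel_mul hα hα one_pos ht
  simp only [sub_self, Real.rpow_zero, mul_one] at hI
  refine sub_le_sub_left (setIntegral_mono_set hI ?_ (Ioc_subset_Ioc_right hst).eventuallyLE) _
  filter_upwards [ae_restrict_mem measurableSet_Ioc] with x hx
  exact (mittagLefflerKernel_self_pos hα hα1 hx.1).le

theorem mittagLefflerKernel_one_le {α t : ℝ} (hα : 0 < α) (hα1 : α < 1) (ht : 0 < t) :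
    mittagLefflerKernel α 1 t ≤ Real.Gamma α * α * t ^ (-α) := by
  have hΓ := Real.Gamma_pos_of_pos hα
  have hV := mittagLefflerKernel_volterra hα one_pos ht
  have hu := mittagLefflerKernel_one_nonneg hα hα1 ht
  have h : mittagLefflerKernel α 1 t * (t ^ α / α) ≤
      ∫ s in Ioc 0 t, mittagLefflerKernel α 1 s * (t - s) ^ (α - 1) := by
    have e := integral_sub_rpow hα ht.le
    rw [sub_zero] at e
    rw [← e, ← integral_const_mul]
    refine setIntegral_mono_on ((integrableOn_sub_rpow hα ht.le).const_mul _)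
      (integrableOn_mittagLefflerKernel_mul hα one_pos hα ht) measurableSet_Ioc fun s hs => ?_
    exact mul_le_mul_of_nonneg_right (mittagLefflerKernel_one_antitoneOn hα hα1 hs.1 ht hs.2)
      (Real.rpow_nonneg (sub_nonneg.2 hs.2) _)
  simp only [sub_self, Real.rpow_zero, Real.Gamma_one, div_one, mul_one] at hV
  have h' : mittagLefflerKernel α 1 t * (t ^ α / α) ≤ Real.Gamma α := by
    nlinarith [mul_nonneg hΓ.le hu]
  have hp : 0 < t ^ α := Real.rpow_pos_of_pos ht _
  rw [Real.rpow_neg ht.le, ← div_eq_mul_inv, le_div_iff₀ hp]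
  rwa [← mul_div_assoc, div_le_iff₀ hα] at h'

theorem integrableOn_mittagLeffler_sq {α : ℝ} (hα : 1 / 2 < α) (hα1 : α < 1) :
    IntegrableOn (fun t : ℝ => mittagLeffler α 1 (-(t ^ α)) ^ 2) (Ioi 0) := by
  have hα0 : 0 < α := by linarith
  have hc : Continuous fun t : ℝ => mittagLeffler α 1 (-(t ^ α)) ^ 2 :=
    (continuous_mittagLeffler_neg_rpow hα0 one_pos).pow 2
  rw [← Ioc_union_Ioi_eq_Ioi (zero_le_one (α := ℝ)), integrableOn_union]
  refine ⟨(hc.continuousOn.integrableOn_Icc).mono_set Ioc_subset_Icc_self, ?_⟩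
  refine Integrable.mono' ((integrableOn_Ioi_rpow_of_lt (by linarith : -2 * α < -1)
    one_pos).const_mul ((Real.Gamma α * α) ^ 2)) hc.aestronglyMeasurable ?_
  filter_upwards [ae_restrict_mem measurableSet_Ioi] with t ht
  have ht0 : 0 < t := one_pos.trans ht
  have hle := mittagLefflerKernel_one_le hα0 hα1 ht0
  have hnn := mittagLefflerKernel_one_nonneg hα0 hα1 ht0
  rw [mittagLefflerKernel_one] at hle hnn
  rw [Real.norm_of_nonneg (sq_nonneg _)]
  calc _ ≤ (Real.Gamma α * α * t ^ (-α)) ^ 2 := by gcongr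
    _ = _ := by
      rw [mul_pow, ← Real.rpow_natCast (t ^ (-α)), ← Real.rpow_mul ht0.le]
      congr 2
      push_cast
      ring

/-- Let `α ∈ (1/2, 1)` and `τ₀, k₀, ρ*, μ₀ > 0`. With
`f(u) = (E_α(-(u/τ₀)^α))²`, the normalizing constant
`e₀ = (k₀²/(ρ* μ₀)) ∫_0^∞ f(u) du` is finite (`f` is integrable on `(0,∞)`),
and the viscous energy `g(s) = e₀ - (k₀²/(ρ* μ₀)) ∫_0^s f(u) du` equals the
tail integral `(k₀²/(ρ* μ₀)) ∫_s^∞ f(u) du`, is nonincreasing on `[0,∞)`,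
satisfies `0 ≤ g(s) ≤ e₀` for all `s ≥ 0`, and `g(s) → 0` as `s → +∞`. -/
theorem viscous_energy_bounded_tendsto_zero (α τ₀ k₀ ρs μ₀ : ℝ)
    (hα : α ∈ Set.Ioo (1 / 2 : ℝ) 1) (hτ : 0 < τ₀) (hk : 0 < k₀)
    (hρ : 0 < ρs) (hμ : 0 < μ₀)
    (f : ℝ → ℝ) (hf : ∀ u, f u = (mittagLeffler α 1 (-((u / τ₀) ^ α))) ^ 2)
    (e₀ : ℝ) (he₀ : e₀ = (k₀ ^ 2 / (ρs * μ₀)) * ∫ u in Set.Ioi (0 : ℝ), f u)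
    (g : ℝ → ℝ)
    (hg : ∀ s, g s = e₀ - (k₀ ^ 2 / (ρs * μ₀)) * ∫ u in (0 : ℝ)..s, f u) :
    MeasureTheory.IntegrableOn f (Set.Ioi 0) ∧
    (∀ s ≥ (0 : ℝ), g s = (k₀ ^ 2 / (ρs * μ₀)) * ∫ u in Set.Ioi s, f u) ∧
    AntitoneOn g (Set.Ici 0) ∧
    (∀ s ≥ (0 : ℝ), 0 ≤ g s ∧ g s ≤ e₀) ∧
    Filter.Tendsto g Filter.atTop (nhds 0) := by
  obtain ⟨hα2, hα1⟩ := hα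
  have hc : 0 < k₀ ^ 2 / (ρs * μ₀) := by positivity
  have hf0 : ∀ u, 0 ≤ f u := fun u => hf u ▸ sq_nonneg _
  have hfi : IntegrableOn f (Ioi 0) := by
    have h := (integrableOn_Ioi_comp_mul_left_iff
      (fun t : ℝ => mittagLeffler α 1 (-(t ^ α)) ^ 2) 0 (inv_pos.2 hτ)).2
      (by rw [mul_zero]; exact integrableOn_mittagLeffler_sq hα2 hα1)
    refine h.congr_fun (fun u _ => ?_) measurableSet_Ioi
    simp only [hf, div_eq_inv_mul]
  have htail : ∀ s ≥ (0 : ℝ), g s = (k₀ ^ 2 / (ρs * μ₀)) * ∫ u in Ioi s, f u := fun s hs => by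
    rw [hg, he₀, intervalIntegral.integral_of_le hs, ← Ioc_union_Ioi_eq_Ioi hs,
      setIntegral_union (Ioc_disjoint_Ioi le_rfl) measurableSet_Ioi
        (hfi.mono_set Ioc_subset_Ioi_self) (hfi.mono_set (Ioi_subset_Ioi hs))]
    ring
  have hanti : AntitoneOn g (Ici 0) := fun s hs t ht hst => by
    rw [htail s hs, htail t ht]
    refine mul_le_mul_of_nonneg_left ?_ hc.le
    exact setIntegral_mono_set (hfi.mono_set (Ioi_subset_Ioi hs))
      (Eventually.of_forall hf0) (Ioi_subset_Ioi hst).eventuallyLE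
  refine ⟨hfi, htail, hanti, fun s hs => ⟨?_, ?_⟩, ?_⟩
  · rw [htail s hs]
    exact mul_nonneg hc.le (integral_nonneg hf0)
  · have h := hanti self_mem_Ici hs hs
    rwa [htail 0 le_rfl, ← he₀] at h
  · have h := ((intervalIntegral_tendsto_integral_Ioi 0 hfi tendsto_id).const_mul
      (k₀ ^ 2 / (ρs * μ₀))).const_sub e₀
    rw [← he₀, sub_self] at h
    exact h.congr fun s => (hg s).symm
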